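/- Let 𝒯=(V,ℰ) be a leafless, locally finite rooted directed tree of finite branching index, let q be an integer greater than 1, let S_{λ,q} be the Dirichlet shift on ℓ²(V), and let S' = S_{λ,q}(S_{λ,q}*S_{λ,q})^{-1} be its Cauchy dual. For a ∈ 𝔻 and β ∈ ℂ with |β| = 1, the operator I − conj(a)·S' is invertible, and the Möbius image φ_{β,a}(S') := β·(S' − a·I)·(I − conj(a)·S')^{-1} is well-defined. Then S' is homogeneous—meaning that for every a ∈ 𝔻 and every β ∈ ℂ with |β| = 1 there exists a unitary operator U on ℓ²(V) with U S' = φ_{β,a}(S') U—if and only if 𝒯 has no branching vertex (equivalently, 𝒯 is isomorphic to ℕ). -/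

import Mathlib

open scoped ENNReal InnerProductSpace
open ContinuousLinearMap

noncomputable section

/-- A (countably infinite) rooted directed tree. -/
structure DirTree (V : Type) where
  edge : V → V → Prop
  not_self : ∀ v, ¬ edge v v
  no_circuit : ∀ v, ¬ Relation.TransGen edge v v
  connected : ∀ u v : V, Relation.ReflTransGen (fun a b => edge a b ∨ edge b a) u v
  uniq_parent : ∀ {u w v : V}, edge u v → edge w v → u = w
  root : V
  root_no_parent : ∀ u, ¬ edge u root
  root_uniq : ∀ v, (∀ u, ¬ edge u v) → v = root

namespace DirTree

variable {V : Type} (T : DirTree V)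

/-- The set of children of a vertex. -/
def chi (v : V) : Set V := {u | T.edge v u}

/-- Leafless: every vertex has a child. -/
def Leafless : Prop := ∀ v : V, ∃ u, T.edge v u

/-- Locally finite: every vertex has finitely many children. -/
def LocFin : Prop := ∀ v : V, (T.chi v).Finite

/-- The finset of children of a vertex (locally finite case). -/
def chiFin (hT : T.LocFin) (v : V) : Finset V := (hT v).toFinset

/-- Iterated child sets `Chi^⟨n⟩(W)`. -/
def chiIter (T : DirTree V) : ℕ → Set V → Set V
  | 0, W => W
  | n + 1, W => {u | ∃ v ∈ chiIter T n W, T.edge v u}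

/-- The depth of a vertex: the unique `n` with `v ∈ Chi^⟨n⟩(root)`. -/
def depth (v : V) : ℕ := sInf {n | v ∈ T.chiIter n {T.root}}

/-- The parent map (junk value at the root). -/
def par (v : V) : V :=
  letI := Classical.propDecidable (∃ u, T.edge u v)
  if h : ∃ u, T.edge u v then h.choose else v

end DirTree

/-- `ℓ²(V)`. -/
abbrev l2 (V : Type) := lp (fun _ : V => ℂ) 2

/-- The standard orthonormal basis vector `e_v` of `ℓ²(V)`. -/
def evec {V : Type} (v : V) : l2 V :=
  letI := Classical.decEq V
  lp.single 2 v 1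

/-- The Pochhammer symbol `(x)_k = x (x+1) ⋯ (x+k-1)`. -/
def poch (x : ℝ) (k : ℕ) : ℝ := ∏ i ∈ Finset.range k, (x + i)

namespace DirTree

variable {V : Type} (T : DirTree V)

/-- The weight `λ_{u,q}` (for any child `u` of `v`). -/
def wt (hT : T.LocFin) (q : ℝ) (v : V) : ℝ :=
  Real.sqrt (((T.depth v : ℝ) + q) / ((T.depth v : ℝ) + 1)) /
    Real.sqrt ((T.chiFin hT v).card)

/-- `S` is the Dirichlet shift with parameter `q` on `ℓ²(V)`:
`S e_v = ∑_{u ∈ Chi(v)} λ_{u,q} e_u`. -/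
def IsDirichletShift (hT : T.LocFin) (q : ℝ) (S : l2 V →L[ℂ] l2 V) : Prop :=
  ∀ v : V, S (evec v) = ∑ u ∈ T.chiFin hT v, ((T.wt hT q v : ℝ) : ℂ) • evec u

end DirTree

/-- The Cauchy dual `S (S*S)⁻¹` of a left-invertible operator. -/
def cauchyDual {V : Type} (S : l2 V →L[ℂ] l2 V) : l2 V →L[ℂ] l2 V :=
  S * Ring.inverse (ContinuousLinearMap.adjoint S * S)

namespace DirTree

section Combinatorics

variable {V : Type} (T : DirTree V)

theorem exists_mem_chiIter (v : V) : ∃ n, v ∈ T.chiIter n {T.root} := by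
  induction T.connected T.root v with
  | refl => exact ⟨0, rfl⟩
  | @tail b c _ hbc ih =>
    obtain ⟨n, hn⟩ := ih
    rcases hbc with h | h
    · exact ⟨n + 1, b, hn, h⟩
    · cases n with
      | zero =>
        have hb : b = T.root := hn
        exact absurd (hb ▸ h) (T.root_no_parent c)
      | succ n =>
        obtain ⟨w, hw, hwb⟩ := hn
        exact ⟨n, T.uniq_parent h hwb ▸ hw⟩

theorem chiIter_root_unique {n m : ℕ} {v : V} (hn : v ∈ T.chiIter n {T.root})
    (hm : v ∈ T.chiIter m {T.root}) : n = m := by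
  induction n generalizing m v with
  | zero =>
    have hv : v = T.root := hn
    cases m with
    | zero => rfl
    | succ m =>
      obtain ⟨w, -, hw⟩ := hm
      exact absurd (hv ▸ hw) (T.root_no_parent w)
  | succ n ih =>
    obtain ⟨w, hw, hwv⟩ := hn
    cases m with
    | zero =>
      have hv : v = T.root := hm
      exact absurd (hv ▸ hwv) (T.root_no_parent w)
    | succ m =>
      obtain ⟨w', hw', hwv'⟩ := hm
      rw [ih hw (T.uniq_parent hwv' hwv ▸ hw')]

theorem mem_chiIter_depth (v : V) : v ∈ T.chiIter (T.depth v) {T.root} :=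
  Nat.sInf_mem (T.exists_mem_chiIter v)

theorem depth_of_edge {v u : V} (h : T.edge v u) : T.depth u = T.depth v + 1 :=
  T.chiIter_root_unique (T.mem_chiIter_depth u) ⟨v, T.mem_chiIter_depth v, h⟩

theorem depth_root : T.depth T.root = 0 :=
  T.chiIter_root_unique (T.mem_chiIter_depth _) rfl

theorem eq_root_of_depth_eq_zero {v : V} (h : T.depth v = 0) : v = T.root := by
  have := T.mem_chiIter_depth v
  rw [h] at this
  exact this

theorem exists_edge_of_depth_pos {u : V} (h : 0 < T.depth u) : ∃ v, T.edge v u := by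
  by_contra! hu
  rw [T.root_uniq u hu, T.depth_root] at h
  exact lt_irrefl 0 h

variable {T}

theorem mem_chiFin (hT : T.LocFin) {v u : V} : u ∈ T.chiFin hT v ↔ T.edge v u := by
  simp [chiFin, chi]

theorem Leafless.card_pos (hL : T.Leafless) (hT : T.LocFin) (v : V) :
    0 < (T.chiFin hT v).card := by
  obtain ⟨u, hu⟩ := hL v
  exact Finset.card_pos.2 ⟨u, (mem_chiFin hT).2 hu⟩

theorem chiFin_eq_singleton (hT : T.LocFin) {v u : V} (hc : (T.chiFin hT v).card ≤ 1)
    (h : T.edge v u) : T.chiFin hT v = {u} := by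
  refine Finset.eq_singleton_iff_unique_mem.2 ⟨(mem_chiFin hT).2 h, fun x hx => ?_⟩
  exact Finset.card_le_one.1 hc x hx u ((mem_chiFin hT).2 h)

end Combinatorics

end DirTree

section StandardBasis

variable {V : Type}

theorem evec_apply [DecidableEq V] (v u : V) : (evec v : l2 V) u = if u = v then 1 else 0 := by
  unfold evec
  by_cases h : u = v
  · subst h
    simp
  · simp [h]

theorem inner_evec_left (v : V) (f : l2 V) : ⟪evec v, f⟫_ℂ = f v := by
  classical
  unfold evec
  rw [lp.inner_single_left]
  simp

end StandardBasis

namespace DirTree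

variable {V : Type} {T : DirTree V}

/-- `A` is the weighted shift on the tree whose edges leaving `v` all carry the weight `c v`. -/
def IsTreeShift (T : DirTree V) (hT : T.LocFin) (c : V → ℝ) (A : l2 V →L[ℂ] l2 V) : Prop :=
  ∀ v : V, A (evec v) = ∑ u ∈ T.chiFin hT v, ((c v : ℝ) : ℂ) • evec u

namespace IsTreeShift

variable {hT : T.LocFin} {c : V → ℝ} {A : l2 V →L[ℂ] l2 V}

theorem adjoint_apply (hA : T.IsTreeShift hT c A) (f : l2 V) (v : V) :
    (ContinuousLinearMap.adjoint A f) v = c v * ∑ u ∈ T.chiFin hT v, f u := by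
  rw [← inner_evec_left, ContinuousLinearMap.adjoint_inner_right, hA v, sum_inner, Finset.mul_sum]
  refine Finset.sum_congr rfl fun u _ => ?_
  rw [inner_smul_left, inner_evec_left, Complex.conj_ofReal]

theorem apply_of_edge (hA : T.IsTreeShift hT c A) (f : l2 V) {v u : V} (h : T.edge v u) :
    (A f) u = c v * f v := by
  classical
  have key : ContinuousLinearMap.adjoint A (evec u) = (c v : ℂ) • evec v := by
    ext w
    rw [hA.adjoint_apply, lp.coeFn_smul, Pi.smul_apply, evec_apply]
    simp only [evec_apply, Finset.sum_ite_eq', mem_chiFin, smul_eq_mul]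
    by_cases hw : w = v
    · simp [hw, h]
    · have : ¬ T.edge w u := fun h' => hw (T.uniq_parent h' h)
      simp [hw, this]
  rw [← inner_evec_left, ← ContinuousLinearMap.adjoint_inner_left, key, inner_smul_left,
    inner_evec_left, Complex.conj_ofReal]

theorem apply_root (hA : T.IsTreeShift hT c A) (f : l2 V) : (A f) T.root = 0 := by
  classical
  have key : ContinuousLinearMap.adjoint A (evec T.root) = 0 := by
    ext w
    rw [hA.adjoint_apply]
    simp [evec_apply, mem_chiFin, T.root_no_parent]
  rw [← inner_evec_left, ← ContinuousLinearMap.adjoint_inner_left, key, inner_zero_left]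

theorem adjoint_apply_apply (hA : T.IsTreeShift hT c A) (f : l2 V) (v : V) :
    (ContinuousLinearMap.adjoint A (A f)) v =
      ((c v ^ 2 * (T.chiFin hT v).card : ℝ) : ℂ) * f v := by
  have hsum : ∑ u ∈ T.chiFin hT v, (A f) u = ∑ _u ∈ T.chiFin hT v, c v * f v :=
    Finset.sum_congr rfl fun u hu => hA.apply_of_edge f ((mem_chiFin hT).1 hu)
  rw [hA.adjoint_apply, hsum, Finset.sum_const, nsmul_eq_mul]
  push_cast
  ring

end IsTreeShift

/-- The weights of the Cauchy dual of the Dirichlet shift. -/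
def dualWt (T : DirTree V) (hT : T.LocFin) (q : ℝ) (v : V) : ℝ :=
  Real.sqrt (((T.depth v : ℝ) + 1) / ((T.depth v : ℝ) + q)) /
    Real.sqrt ((T.chiFin hT v).card)

theorem dualWt_sq_mul_card (hL : T.Leafless) (hT : T.LocFin) {q : ℝ} (hq : 1 ≤ q) (v : V) :
    T.dualWt hT q v ^ 2 * (T.chiFin hT v).card = ((T.depth v : ℝ) + 1) / ((T.depth v : ℝ) + q) := by
  have hc : (0 : ℝ) < (T.chiFin hT v).card := by exact_mod_cast hL.card_pos hT v
  rw [dualWt, div_pow, Real.sq_sqrt hc.le, Real.sq_sqrt (by positivity), div_mul_cancel₀ _ hc.ne']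

theorem dualWt_pos (hL : T.Leafless) (hT : T.LocFin) {q : ℝ} (hq : 1 ≤ q) (v : V) :
    0 < T.dualWt hT q v := by
  have hc : (0 : ℝ) < (T.chiFin hT v).card := by exact_mod_cast hL.card_pos hT v
  unfold dualWt
  positivity

/-- Multiplication by a bounded real function on `ℓ²(V)`. -/
def diagOp (d : V → ℝ) (hd : ∀ v, |d v| ≤ 1) : l2 V →L[ℂ] l2 V :=
  lp.mapCLM 2 (fun v => (d v : ℂ) • ContinuousLinearMap.id ℂ ℂ) zero_le_one fun v => by
    rw [norm_smul, ContinuousLinearMap.norm_id, mul_one, Complex.norm_real]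
    exact hd v

theorem diagOp_apply (d : V → ℝ) (hd : ∀ v, |d v| ≤ 1) (f : l2 V) (v : V) :
    diagOp d hd f v = d v * f v := by
  simp [diagOp]

theorem norm_diagOp_le (d : V → ℝ) (hd : ∀ v, |d v| ≤ 1) : ‖diagOp d hd‖ ≤ 1 :=
  lp.norm_mapCLM_le _ _ _ _

theorem isTreeShift_cauchyDual (hL : T.Leafless) (hT : T.LocFin) {q : ℝ} (hq : 1 ≤ q)
    {S : l2 V →L[ℂ] l2 V} (hS : T.IsDirichletShift hT q S) :
    T.IsTreeShift hT (T.dualWt hT q) (cauchyDual S) := by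
  classical
  have hS' : T.IsTreeShift hT (T.wt hT q) S := hS
  have hc (v : V) : (0 : ℝ) < (T.chiFin hT v).card := by exact_mod_cast hL.card_pos hT v
  set d : V → ℝ := fun v => ((T.depth v : ℝ) + 1) / ((T.depth v : ℝ) + q) with hd_def
  have hd0 (v : V) : 0 < d v := by simp only [hd_def]; positivity
  have hd (v : V) : |d v| ≤ 1 := by
    rw [abs_of_pos (hd0 v)]
    exact (div_le_one (by positivity)).2 (by linarith)
  have hwt (v : V) : T.wt hT q v ^ 2 * (T.chiFin hT v).card = (d v)⁻¹ := by
    rw [wt, div_pow, Real.sq_sqrt (hc v).le, Real.sq_sqrt (by positivity),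
      div_mul_cancel₀ _ (hc v).ne', hd_def, inv_div]
  have hinv : Ring.inverse (ContinuousLinearMap.adjoint S * S) = diagOp d hd := by
    have h1 : (ContinuousLinearMap.adjoint S * S) * diagOp d hd = 1 := by
      ext f v
      change (ContinuousLinearMap.adjoint S (S (diagOp d hd f))) v = f v
      rw [hS'.adjoint_apply_apply, diagOp_apply, hwt, ← mul_assoc, ← Complex.ofReal_mul,
        inv_mul_cancel₀ (hd0 v).ne', Complex.ofReal_one, one_mul]
    have h2 : diagOp d hd * (ContinuousLinearMap.adjoint S * S) = 1 := by
      ext f v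
      change (diagOp d hd (ContinuousLinearMap.adjoint S (S f))) v = f v
      rw [diagOp_apply, hS'.adjoint_apply_apply, hwt, ← mul_assoc, ← Complex.ofReal_mul,
        mul_inv_cancel₀ (hd0 v).ne', Complex.ofReal_one, one_mul]
    exact Ring.inverse_unit ⟨_, _, h1, h2⟩
  intro v
  have hdiag : diagOp d hd (evec v) = (d v : ℂ) • evec v := by
    ext u
    rw [diagOp_apply, lp.coeFn_smul, Pi.smul_apply, smul_eq_mul, evec_apply]
    split_ifs with h
    · rw [h]
    · simp
  have hw : d v * T.wt hT q v = T.dualWt hT q v := by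
    have hs : d v * √(d v)⁻¹ = √(d v) := by
      rw [Real.sqrt_inv]
      nth_rewrite 1 [← Real.mul_self_sqrt (hd0 v).le]
      exact mul_inv_cancel_right₀ (Real.sqrt_pos.2 (hd0 v)).ne' _
    have : ((T.depth v : ℝ) + q) / ((T.depth v : ℝ) + 1) = (d v)⁻¹ := by rw [hd_def, inv_div]
    rw [wt, dualWt, this, ← mul_div_assoc, hs]
  rw [cauchyDual, hinv]
  change S (diagOp d hd (evec v)) = _
  rw [hdiag, map_smul, hS v, Finset.smul_sum]
  refine Finset.sum_congr rfl fun u _ => ?_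
  rw [smul_smul, ← Complex.ofReal_mul, hw]

theorem IsTreeShift.adjoint_apply_apply_dualWt (hL : T.Leafless) {hT : T.LocFin} {q : ℝ}
    (hq : 1 ≤ q) {A : l2 V →L[ℂ] l2 V} (hA : T.IsTreeShift hT (T.dualWt hT q) A)
    (f : l2 V) (v : V) :
    (ContinuousLinearMap.adjoint A (A f)) v =
      ((((T.depth v : ℝ) + 1) / ((T.depth v : ℝ) + q) : ℝ) : ℂ) * f v := by
  rw [hA.adjoint_apply_apply, dualWt_sq_mul_card hL hT hq]

theorem IsTreeShift.norm_le_one_of_dualWt (hL : T.Leafless) {hT : T.LocFin} {q : ℝ}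
    (hq : 1 ≤ q) {A : l2 V →L[ℂ] l2 V} (hA : T.IsTreeShift hT (T.dualWt hT q) A) : ‖A‖ ≤ 1 := by
  set d : V → ℝ := fun v => ((T.depth v : ℝ) + 1) / ((T.depth v : ℝ) + q) with hd_def
  have hd (v : V) : |d v| ≤ 1 := by
    rw [abs_of_nonneg (by simp only [hd_def]; positivity)]
    exact (div_le_one (by positivity)).2 (by linarith)
  have h : ContinuousLinearMap.adjoint A ∘L A = diagOp d hd := by
    ext f v
    rw [diagOp_apply]
    exact hA.adjoint_apply_apply_dualWt hL hq f v
  have h2 := ContinuousLinearMap.norm_adjoint_comp_self A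
  rw [h] at h2
  have h3 := norm_diagOp_le d hd
  nlinarith [norm_nonneg A]

end DirTree

section HeredDefect

variable {A : Type*} [Ring A] [StarRing A] {x : A}

/-- The hereditary defect map `y ↦ y - x y x*`. -/
def heredDefect (x y : A) : A := y - x * y * star x

theorem heredDefect_mul_mul_star {r : A} (h : Commute x r) (y : A) :
    heredDefect x (r * y * star r) = r * heredDefect x y * star r := by
  have h' : star r * star x = star x * star r := by rw [← star_mul, ← star_mul, h.eq]
  have e : x * (r * y * star r) * star x = r * (x * y * star x) * star r := by
    calc x * (r * y * star r) * star x = (x * r) * y * (star r * star x) := by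
          simp only [mul_assoc]
      _ = _ := by rw [h.eq, h']; simp only [mul_assoc]
  rw [heredDefect, heredDefect, e, mul_sub, sub_mul]

theorem mul_iterate_heredDefect_of_intertwine {w y : A} (h : w * x = y * w)
    (hw : star w * w = 1) (hw' : w * star w = 1) (k : ℕ) :
    w * (heredDefect x)^[k] 1 = (heredDefect y)^[k] 1 * w := by
  induction k with
  | zero => simp
  | succ k ih =>
    rw [Function.iterate_succ_apply', Function.iterate_succ_apply']
    have hs : w * star x = star y * w := by
      have : star x * star w = star w * star y := by rw [← star_mul, ← star_mul, h]
      calc w * star x = w * (star x * star w) * w := by rw [mul_assoc, mul_assoc, hw, mul_one]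
        _ = (w * star w) * star y * w := by rw [this]; simp only [mul_assoc]
        _ = _ := by rw [hw', one_mul]
    simp only [heredDefect, mul_sub, sub_mul] at ih ⊢
    rw [ih]
    congr 1
    rw [← mul_assoc, ← mul_assoc, h, mul_assoc y w, ih]
    simp only [mul_assoc]
    rw [hs]

end HeredDefect

section Mobius

variable {A : Type*} [Ring A] [Algebra ℂ A]

/-- The image of `x` under the Möbius transformation `z ↦ β (z - a) / (1 - conj a z)`. -/
def mobius (a β : ℂ) (x : A) : A :=
  β • ((x - a • 1) * Ring.inverse (1 - (starRingEnd ℂ a) • x))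

variable {a β : ℂ} {x : A}

theorem commute_inverse_one_sub_smul (hu : IsUnit (1 - (starRingEnd ℂ a) • x)) :
    Commute x (Ring.inverse (1 - (starRingEnd ℂ a) • x)) := by
  have hc : x * (1 - (starRingEnd ℂ a) • x) = (1 - (starRingEnd ℂ a) • x) * x := by
    simp [mul_sub, sub_mul]
  rw [Ring.inverse_of_isUnit hu]
  exact Commute.units_inv_right (u := hu.unit) hc

theorem mobius_mul_one_sub (hu : IsUnit (1 - (starRingEnd ℂ a) • x)) :
    mobius a β x * (1 - (starRingEnd ℂ a) • x) = β • (x - a • 1) := by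
  rw [mobius, smul_mul_assoc, mul_assoc, Ring.inverse_mul_cancel _ hu, mul_one]

theorem mobius_eq_inverse_mul (hu : IsUnit (1 - (starRingEnd ℂ a) • x)) :
    mobius a β x = Ring.inverse (1 - (starRingEnd ℂ a) • x) * (β • (x - a • 1)) := by
  rw [mobius, mul_smul_comm]
  congr 1
  exact (commute_inverse_one_sub_smul hu).sub_left ((Commute.one_left _).smul_left a)

theorem mul_conj_of_norm_eq_one (hβ : ‖β‖ = 1) : β * (starRingEnd ℂ) β = 1 := by
  rw [Complex.mul_conj, Complex.normSq_eq_norm_sq, hβ]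
  simp

variable [StarRing A] [StarModule ℂ A]

theorem heredDefect_mobius (hu : IsUnit (1 - (starRingEnd ℂ a) • x)) (hβ : ‖β‖ = 1) (y : A) :
    heredDefect (mobius a β x) y = (1 - a * (starRingEnd ℂ) a) •
      (Ring.inverse (1 - (starRingEnd ℂ a) • x) * heredDefect x y *
        star (Ring.inverse (1 - (starRingEnd ℂ a) • x))) := by
  have hm := mobius_eq_inverse_mul (β := β) hu
  set c := 1 - (starRingEnd ℂ a) • x with hc
  set r := Ring.inverse c
  have hrc : r * c = 1 := Ring.inverse_mul_cancel _ hu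
  have hcr : star c * star r = 1 := by rw [← star_mul, hrc, star_one]
  have hy : y = r * (c * y * star c) * star r := by
    calc y = (r * c) * y * (star c * star r) := by rw [hrc, hcr, one_mul, mul_one]
      _ = _ := by simp only [mul_assoc]
  have hb := mul_conj_of_norm_eq_one hβ
  have hφ : mobius a β x * y * star (mobius a β x) =
      r * ((x - a • 1) * y * star (x - a • 1)) * star r := by
    rw [hm, star_mul, star_smul]
    simp only [mul_smul_comm, smul_mul_assoc, smul_smul, mul_assoc]
    rw [mul_comm, RCLike.star_def, hb, one_smul]
  have key : c * y * star c - (x - a • 1) * y * star (x - a • 1) =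
      (1 - a * (starRingEnd ℂ) a) • heredDefect x y := by
    rw [hc, heredDefect]
    simp only [star_sub, star_smul, star_one, RCLike.star_def, Complex.conj_conj, sub_mul, mul_sub,
      one_mul, mul_one, smul_mul_assoc, mul_smul_comm, smul_sub, smul_smul, sub_smul, one_smul]
    rw [mul_comm ((starRingEnd ℂ) a) a]
    abel
  calc heredDefect (mobius a β x) y = y - mobius a β x * y * star (mobius a β x) := rfl
    _ = r * (c * y * star c) * star r - r * ((x - a • 1) * y * star (x - a • 1)) * star r := by
      rw [hφ, ← hy]
    _ = r * (c * y * star c - (x - a • 1) * y * star (x - a • 1)) * star r := by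
      rw [mul_sub r, sub_mul _ _ (star r)]
    _ = _ := by rw [key, mul_smul_comm, smul_mul_assoc]

theorem iterate_heredDefect_mobius (hu : IsUnit (1 - (starRingEnd ℂ a) • x)) (hβ : ‖β‖ = 1)
    (k : ℕ) :
    (heredDefect (mobius a β x))^[k] 1 = (1 - a * (starRingEnd ℂ) a) ^ k •
      (Ring.inverse (1 - (starRingEnd ℂ a) • x) ^ k * (heredDefect x)^[k] 1 *
        star (Ring.inverse (1 - (starRingEnd ℂ a) • x) ^ k)) := by
  induction k with
  | zero => simp
  | succ k ih =>
    have hcomm := (commute_inverse_one_sub_smul hu).pow_right k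
    rw [Function.iterate_succ_apply', ih, heredDefect_mobius hu hβ]
    have hsm (t : ℂ) (y : A) : heredDefect x (t • y) = t • heredDefect x y := by
      simp [heredDefect, smul_sub]
    rw [hsm, heredDefect_mul_mul_star hcomm, Function.iterate_succ_apply' (heredDefect x)]
    rw [mul_smul_comm, smul_mul_assoc, smul_smul, ← pow_succ']
    congr 1
    rw [pow_succ', star_mul]
    simp only [mul_assoc]

end Mobius

section FwdDiff

/-- The rising product `∏_{i<k} (j + c + i)` as a function of `j`. -/
def risingProd (k : ℕ) (c : ℂ) (j : ℕ) : ℂ := ∏ i ∈ Finset.range k, ((j : ℂ) + c + i)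

theorem fwdDiff_risingProd (k : ℕ) (c : ℂ) :
    fwdDiff 1 (risingProd (k + 1) c) = ((k : ℂ) + 1) • risingProd k (c + 1) := by
  funext j
  rw [fwdDiff, Pi.smul_apply, smul_eq_mul]
  unfold risingProd
  rw [Finset.prod_range_succ, Finset.prod_range_succ']
  have h1 : ∏ i ∈ Finset.range k, (((j + 1 : ℕ) : ℂ) + c + i) =
      ∏ i ∈ Finset.range k, ((j : ℂ) + (c + 1) + i) :=
    Finset.prod_congr rfl fun i _ => by push_cast; ring
  have h2 : ∏ i ∈ Finset.range k, ((j : ℂ) + c + (i + 1 : ℕ)) =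
      ∏ i ∈ Finset.range k, ((j : ℂ) + (c + 1) + i) :=
    Finset.prod_congr rfl fun i _ => by push_cast; ring
  rw [h1, h2]
  push_cast
  ring

theorem iterate_fwdDiff_risingProd (k : ℕ) (c : ℂ) :
    (fwdDiff 1)^[k] (risingProd k c) = fun _ => (k.factorial : ℂ) := by
  induction k generalizing c with
  | zero => funext j; simp [risingProd]
  | succ k ih =>
    rw [Function.iterate_succ_apply, fwdDiff_risingProd, fwdDiff_iter_const_smul, ih]
    funext j
    simp [Nat.factorial_succ]

theorem iterate_succ_fwdDiff_risingProd (k : ℕ) (c : ℂ) :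
    (fwdDiff 1)^[k + 1] (risingProd k c) = 0 := by
  rw [Function.iterate_succ_apply', iterate_fwdDiff_risingProd]
  funext j
  simp [fwdDiff]

theorem slope_eq_zero_of_iterate_fwdDiff (p : ℕ) (c s t : ℂ)
    (h : (fwdDiff 1)^[p + 1] (fun j : ℕ => (s + t * j) * risingProd p c j) 0 = 0) : t = 0 := by
  have e : (fun j : ℕ => (s + t * j) * risingProd p c j) =
      t • risingProd (p + 1) c + (s - t * (c + p)) • risingProd p c := by
    funext j
    have : risingProd (p + 1) c j = risingProd p c j * (j + c + p) := Finset.prod_range_succ _ _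
    simp only [Pi.add_apply, Pi.smul_apply, smul_eq_mul, this]
    ring
  rw [e, fwdDiff_iter_add, fwdDiff_iter_const_smul, fwdDiff_iter_const_smul,
    iterate_fwdDiff_risingProd, iterate_succ_fwdDiff_risingProd] at h
  simpa [Nat.factorial_ne_zero] using h

end FwdDiff

/-- Along a path on which `A` acts as a unilateral shift with the weights `w`, a vector annihilated
by `(A* - b)²` and by `(1 - b A)^(p+1)` is already annihilated by `A* - b`. -/
theorem adjoint_apply_eq_smul_on_path {V : Type} {A : l2 V →L[ℂ] l2 V} {v : ℕ → V} {w : ℕ → ℂ}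
    {n p : ℕ} {b : ℂ} (hb : b ≠ 0) (hw0 : ∀ j, w j ≠ 0)
    (hw : ∀ j : ℕ, w j ^ 2 = ((n : ℂ) + j + 1) / ((n : ℂ) + j + (p + 1)))
    (hA : ∀ (f : l2 V) j, (A f) (v (j + 1)) = w j * f (v j))
    (hA' : ∀ (f : l2 V) j, (ContinuousLinearMap.adjoint A f) (v j) = w j * f (v (j + 1)))
    {g h : l2 V} (hh : h = ContinuousLinearMap.adjoint A g - b • g)
    (hAh : ContinuousLinearMap.adjoint A h = b • h)
    (hpow : ∀ j, (((1 - b • A) ^ (p + 1)) g) (v j) = 0) : h (v 0) = 0 := by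
  set B : ℕ → ℂ := fun j => ∏ i ∈ Finset.range j, w i with hB
  have hB0 (j : ℕ) : B j ≠ 0 := Finset.prod_ne_zero_iff.2 fun i _ => hw0 i
  have hBs (j : ℕ) : B (j + 1) = B j * w j := Finset.prod_range_succ _ _
  set y : ℕ → ℂ := fun j => g (v j) / (B j * b ^ j) with hy
  have hgy (j : ℕ) : g (v j) = B j * b ^ j * y j := by
    rw [hy]
    field_simp [hB0 j]
  have hpow' (k j : ℕ) : (((1 - b • A) ^ k) g) (v (j + k)) =
      B (j + k) * b ^ (j + k) * (fwdDiff 1)^[k] y j := by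
    induction k generalizing j with
    | zero => simpa using hgy j
    | succ k ih =>
      have e : (((1 - b • A) ^ (k + 1)) g) (v (j + (k + 1))) =
          (((1 - b • A) ^ k) g) (v (j + k + 1)) - b * (A (((1 - b • A) ^ k) g)) (v (j + k + 1)) := by
        rw [pow_succ']
        rfl
      have e1 := ih (j + 1)
      rw [show j + 1 + k = j + k + 1 by ring] at e1
      rw [e, hA, e1, ih j, Function.iterate_succ_apply', fwdDiff, ← add_assoc, hBs, pow_succ]
      ring
  set z : ℕ → ℂ := fun j => B j ^ 2 * y j with hz
  have hhz (j : ℕ) : B j * h (v j) = b ^ (j + 1) * (z (j + 1) - z j) := by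
    have : h (v j) = w j * g (v (j + 1)) - b * g (v j) := by
      rw [hh, ← hA']
      rfl
    rw [this, hgy, hgy]
    simp only [hz]
    rw [hBs, pow_succ]
    ring
  have hstep (j : ℕ) : z (j + 1 + 1) - z (j + 1) = z (j + 1) - z j := by
    have e1 := hhz (j + 1)
    have e2 : w j * h (v (j + 1)) = b * h (v j) := by
      rw [← hA', hAh]
      rfl
    have e3 : b ^ (j + 1 + 1) * (z (j + 1 + 1) - z (j + 1)) =
        b ^ (j + 1 + 1) * (z (j + 1) - z j) := by
      rw [← e1, hBs, mul_assoc, e2, pow_succ, mul_comm (b ^ (j + 1)) b, mul_assoc, ← hhz j]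
      ring
    exact mul_left_cancel₀ (pow_ne_zero _ hb) e3
  have hslope (j : ℕ) : z (j + 1) - z j = z 1 - z 0 := by
    induction j with
    | zero => rfl
    | succ j ih => rw [hstep, ih]
  have hlin (j : ℕ) : z j = z 0 + (z 1 - z 0) * j := by
    induction j with
    | zero => simp
    | succ j ih =>
      have := hslope j
      push_cast
      linear_combination this + ih
  set c : ℂ := (n : ℂ) + 1 with hc
  have hden (j : ℕ) : (n : ℂ) + j + (p + 1) ≠ 0 := by
    have : ((n + j + (p + 1) : ℕ) : ℂ) ≠ 0 := by
      rw [Nat.cast_ne_zero]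
      omega
    push_cast at this
    exact this
  have hBQ (j : ℕ) : B j ^ 2 * risingProd p c j = risingProd p c 0 := by
    induction j with
    | zero => simp [hB]
    | succ j ih =>
      have e1 : risingProd p c (j + 1) * (j + c) = risingProd (p + 1) c j := by
        unfold risingProd
        rw [Finset.prod_range_succ']
        have : ∏ i ∈ Finset.range p, (((j + 1 : ℕ) : ℂ) + c + i) =
            ∏ i ∈ Finset.range p, ((j : ℂ) + c + (i + 1 : ℕ)) :=
          Finset.prod_congr rfl fun i _ => by push_cast; ring
        rw [this]
        simp
      have e2 : risingProd (p + 1) c j = risingProd p c j * (j + c + p) :=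
        Finset.prod_range_succ _ _
      have e3 : w j ^ 2 * risingProd p c (j + 1) = risingProd p c j := by
        rw [hw, div_mul_eq_mul_div, div_eq_iff (hden j)]
        linear_combination e1 + e2
      rw [hBs, mul_pow, mul_assoc, e3, ih]
  have hP0 : risingProd p c 0 ≠ 0 := by
    refine Finset.prod_ne_zero_iff.2 fun i _ => ?_
    have : ((n + 1 + i : ℕ) : ℂ) ≠ 0 := by
      rw [Nat.cast_ne_zero]
      omega
    push_cast at this
    simpa [hc] using this
  have hyQ : y = fun j : ℕ => (z 0 / risingProd p c 0 + (z 1 - z 0) / risingProd p c 0 * j) *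
      risingProd p c j := by
    funext j
    have e1 := hlin j
    simp only [hz] at e1 ⊢
    have e2 := hBQ j
    have e3 : risingProd p c 0 * y j = (B j ^ 2 * y j) * risingProd p c j := by
      rw [← e2]
      ring
    rw [e1] at e3
    field_simp
    linear_combination e3
  have hΔ : (fwdDiff 1)^[p + 1] y 0 = 0 := by
    have := hpow' (p + 1) 0
    rw [hpow] at this
    have hne : B (0 + (p + 1)) * b ^ (0 + (p + 1)) ≠ 0 := mul_ne_zero (hB0 _) (pow_ne_zero _ hb)
    exact (mul_eq_zero.1 this.symm).resolve_left hne
  rw [hyQ] at hΔ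
  have ht := slope_eq_zero_of_iterate_fwdDiff p c _ _ hΔ
  have hz0 : z 1 - z 0 = 0 := (div_eq_zero_iff.1 ht).resolve_right hP0
  have := hhz 0
  rw [hz0, mul_zero] at this
  exact (mul_eq_zero.1 this).resolve_left (hB0 0)

namespace DirTree

variable {V : Type} {T : DirTree V}

namespace IsTreeShift

variable {hT : T.LocFin}

theorem adjoint_apply_of_card_le_one {c : V → ℝ} {A : l2 V →L[ℂ] l2 V}
    (hA : T.IsTreeShift hT c A) (f : l2 V) {v u : V} (hv : (T.chiFin hT v).card ≤ 1)
    (h : T.edge v u) : (ContinuousLinearMap.adjoint A f) v = c v * f u := by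
  rw [hA.adjoint_apply, chiFin_eq_singleton hT hv h, Finset.sum_singleton]

theorem eq_zero_of_adjoint_eq_smul {c : V → ℝ} {A : l2 V →L[ℂ] l2 V}
    (hA : T.IsTreeShift hT c A) {b : ℂ} (hb : b ≠ 0) {h : l2 V}
    (hh : ContinuousLinearMap.adjoint A h = b • h) {M : ℕ}
    (hM : ∀ v, M ≤ T.depth v → h v = 0) : h = 0 := by
  have key (k : ℕ) : ∀ v, M ≤ T.depth v + k → h v = 0 := by
    induction k with
    | zero => exact hM
    | succ k ih =>
      intro v hv
      have e : b * h v = c v * ∑ u ∈ T.chiFin hT v, h u := by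
        rw [← hA.adjoint_apply, hh]
        rfl
      have hsum : ∑ u ∈ T.chiFin hT v, h u = 0 := by
        refine Finset.sum_eq_zero fun u hu => ih u ?_
        rw [T.depth_of_edge ((mem_chiFin hT).1 hu)]
        omega
      rw [hsum, mul_zero] at e
      exact (mul_eq_zero.1 e).resolve_left hb
  ext v
  exact key M v (by omega)

end IsTreeShift

theorem dualWt_sq_of_card_le_one (hL : T.Leafless) (hT : T.LocFin) {q : ℝ} (hq : 1 ≤ q) {v : V}
    (hv : (T.chiFin hT v).card ≤ 1) :
    ((T.dualWt hT q v : ℝ) : ℂ) ^ 2 = ((T.depth v : ℂ) + 1) / ((T.depth v : ℂ) + q) := by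
  have h1 : (T.chiFin hT v).card = 1 := le_antisymm hv (hL.card_pos hT v)
  have := dualWt_sq_mul_card hL hT hq v
  rw [h1, Nat.cast_one, mul_one] at this
  rw [← Complex.ofReal_pow, this]
  push_cast
  rfl

/-- The eigenvalues of the iterated defect operator of a weighted Bergman shift. -/
def defectCoeff (q i m : ℕ) : ℂ := ∏ j ∈ Finset.range i, ((q : ℂ) - 1 - j) / ((m : ℂ) + q - 1 - j)

theorem mul_defectCoeff (q i m : ℕ) :
    ((m : ℂ) + 1) / ((m : ℂ) + q) * defectCoeff q i m =
      ((m : ℂ) + 1) / ((m : ℂ) + q - i) * defectCoeff q i (m + 1) := by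
  induction i with
  | zero => simp [defectCoeff]
  | succ i ih =>
    have e (m : ℕ) : defectCoeff q (i + 1) m =
        defectCoeff q i m * (((q : ℂ) - 1 - i) / ((m : ℂ) + q - 1 - i)) :=
      Finset.prod_range_succ _ _
    rw [e, e, ← mul_assoc, ih]
    push_cast
    rw [show (m : ℂ) + 1 + q - 1 - i = m + q - i by ring,
      show (m : ℂ) + q - (i + 1) = m + q - 1 - i by ring]
    ring

theorem defectCoeff_succ {q i m : ℕ} (h : i < m + q) :
    defectCoeff q (i + 1) (m + 1) = defectCoeff q i (m + 1) -
      ((m : ℂ) + 1) / ((m : ℂ) + q) * defectCoeff q i m := by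
  have hne : (m : ℂ) + q - i ≠ 0 := by
    have : ((m + q : ℕ) : ℂ) ≠ (i : ℕ) := by
      rw [Ne, Nat.cast_inj]
      omega
    push_cast at this
    exact sub_ne_zero.2 this
  have e : defectCoeff q (i + 1) (m + 1) =
      defectCoeff q i (m + 1) * (((q : ℂ) - 1 - i) / (((m + 1 : ℕ) : ℂ) + q - 1 - i)) :=
    Finset.prod_range_succ _ _
  rw [mul_defectCoeff, e]
  push_cast
  rw [show (m : ℂ) + 1 + q - 1 - i = m + q - i by ring]
  field_simp
  ring

theorem defectCoeff_self {q : ℕ} (hq : 1 ≤ q) (m : ℕ) : defectCoeff q q m = 0 := by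
  refine Finset.prod_eq_zero (Finset.mem_range.2 (Nat.sub_lt hq one_pos)) ?_
  rw [Nat.cast_sub hq]
  simp

section DualShift

variable {hT : T.LocFin} {q : ℕ} {A : l2 V →L[ℂ] l2 V}

theorem iterate_heredDefect_apply (hL : T.Leafless) (hq : 1 ≤ q)
    (hA : T.IsTreeShift hT (T.dualWt hT q) A) {N : ℕ}
    (hN : ∀ v : V, 2 ≤ (T.chiFin hT v).card → T.depth v ≤ N) (i : ℕ) (f : l2 V) (u : V)
    (hu : N + 2 + i ≤ T.depth u) :
    (((heredDefect A)^[i] 1) f) u = defectCoeff q i (T.depth u) * f u := by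
  induction i generalizing f u with
  | zero => simp [defectCoeff]
  | succ i ih =>
    obtain ⟨v, hvu⟩ := T.exists_edge_of_depth_pos (u := u) (by omega)
    have hd := T.depth_of_edge hvu
    have hv : (T.chiFin hT v).card ≤ 1 := by
      by_contra! hc
      have := hN v hc
      omega
    have e : (((heredDefect A)^[i + 1] 1) f) u = (((heredDefect A)^[i] 1) f) u -
        (A (((heredDefect A)^[i] 1) (ContinuousLinearMap.adjoint A f))) u := by
      rw [Function.iterate_succ_apply']
      rfl
    have hsq := dualWt_sq_of_card_le_one hL hT (q := q) (by exact_mod_cast hq) hv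
    rw [e, hA.apply_of_edge _ hvu, ih f u (by omega), ih _ v (by omega),
      hA.adjoint_apply_of_card_le_one f hv hvu, hd, defectCoeff_succ (by omega)]
    simp only [Complex.ofReal_natCast] at hsq
    rw [← hsq]
    ring

/-- The deep part of the tree is a disjoint union of infinite paths. -/
theorem exists_path (hL : T.Leafless) {N : ℕ}
    (hN : ∀ v : V, 2 ≤ (T.chiFin hT v).card → T.depth v ≤ N) {v₀ : V} (hv₀ : N < T.depth v₀) :
    ∃ v : ℕ → V, v 0 = v₀ ∧ (∀ j, T.edge (v j) (v (j + 1))) ∧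
      (∀ j, T.depth (v j) = T.depth v₀ + j) ∧ ∀ j, (T.chiFin hT (v j)).card ≤ 1 := by
  choose child hchild using hL
  refine ⟨fun j => child^[j] v₀, rfl, fun j => ?_, ?_, ?_⟩
  · simp only [Function.iterate_succ_apply']
    exact hchild _
  all_goals
    have hdepth (j : ℕ) : T.depth (child^[j] v₀) = T.depth v₀ + j := by
      induction j with
      | zero => rfl
      | succ j ih => rw [Function.iterate_succ_apply', T.depth_of_edge (hchild _), ih, add_assoc]
  · exact hdepth
  · intro j
    by_contra! hc
    have := hN _ hc
    rw [hdepth] at this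
    omega

/-- Past the branching vertices a vector in the range of the defect operator of order `q`, divided
by `(1 - b A)^q`, has no Jordan block at `b`. -/
theorem adjoint_eq_smul_of_sq (hL : T.Leafless) (hq : 1 ≤ q)
    (hA : T.IsTreeShift hT (T.dualWt hT q) A) {N : ℕ}
    (hN : ∀ v : V, 2 ≤ (T.chiFin hT v).card → T.depth v ≤ N) {b : ℂ} (hb : b ≠ 0) {g f : l2 V}
    (hgf : ((1 - b • A) ^ q) g = ((heredDefect A)^[q] 1) f)
    (hg : ContinuousLinearMap.adjoint A (ContinuousLinearMap.adjoint A g - b • g) =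
      b • (ContinuousLinearMap.adjoint A g - b • g)) :
    ContinuousLinearMap.adjoint A g - b • g = 0 := by
  refine hA.eq_zero_of_adjoint_eq_smul hb hg (M := N + 2 + q) fun v₀ hv₀ => ?_
  obtain ⟨v, h0, hedge, hdepth, hcard⟩ := exists_path (hT := hT) hL hN (v₀ := v₀) (by omega)
  obtain ⟨p, rfl⟩ : ∃ p, q = p + 1 := ⟨q - 1, by omega⟩
  rw [← h0]
  have hq' : (1 : ℝ) ≤ ((p + 1 : ℕ) : ℝ) := by exact_mod_cast hq
  refine adjoint_apply_eq_smul_on_path (A := A) (n := T.depth v₀) (p := p) (g := g)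
    (w := fun j => ((T.dualWt hT ((p + 1 : ℕ) : ℝ) (v j) : ℝ) : ℂ)) hb
    (fun j => ?_) (fun j => ?_) (fun f j => ?_) (fun f j => ?_) rfl hg fun j => ?_
  · exact Complex.ofReal_ne_zero.2 (dualWt_pos hL hT hq' _).ne'
  · rw [dualWt_sq_of_card_le_one hL hT hq' (hcard j), hdepth]
    push_cast
    rfl
  · exact hA.apply_of_edge f (hedge j)
  · exact hA.adjoint_apply_of_card_le_one f (hcard j) (hedge j)
  · rw [hgf, iterate_heredDefect_apply hL hq hA hN _ _ _ (by rw [hdepth]; omega),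
      defectCoeff_self hq, zero_mul]

theorem heredDefect_iterate_apply_of_adjoint_sq_eq_zero {A : l2 V →L[ℂ] l2 V} {z : l2 V}
    (hz : ContinuousLinearMap.adjoint A (ContinuousLinearMap.adjoint A z) = 0) (i : ℕ) :
    ((heredDefect A)^[i] 1) z = z - (i : ℂ) • A (ContinuousLinearMap.adjoint A z) := by
  induction i generalizing z with
  | zero => simp
  | succ i ih =>
    have e : ((heredDefect A)^[i + 1] 1) z = ((heredDefect A)^[i] 1) z -
        A (((heredDefect A)^[i] 1) (ContinuousLinearMap.adjoint A z)) := by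
      rw [Function.iterate_succ_apply']
      rfl
    rw [e, ih hz, ih (by rw [hz, map_zero]), hz]
    simp only [map_zero, smul_zero, sub_zero]
    push_cast
    rw [add_smul, one_smul]
    abel

/-- A branching vertex yields an eigenvector of the defect operator of order `q` that is killed by
the square of the adjoint but not by the adjoint. -/
theorem exists_defect_eigenvector (hL : T.Leafless) (hq : 2 ≤ q)
    (hA : T.IsTreeShift hT (T.dualWt hT q) A) {p : V} (hp : 2 ≤ (T.chiFin hT p).card) :
    ∃ (z : l2 V) (δ : ℂ), δ ≠ 0 ∧ ((heredDefect A)^[q] 1) z = δ • z ∧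
      ContinuousLinearMap.adjoint A z ≠ 0 ∧
      ContinuousLinearMap.adjoint A (ContinuousLinearMap.adjoint A z) = 0 := by
  classical
  obtain ⟨u₁, h₁, u₂, h₂, hne⟩ := Finset.one_lt_card.1 hp
  set k := T.depth p + 1 with hk
  set t : ℂ := ((((k : ℝ) + 1) / ((k : ℝ) + q) : ℝ) : ℂ) with ht
  have hkq : (0 : ℝ) < (k : ℝ) + q := by positivity
  have ht0 : t ≠ 0 := Complex.ofReal_ne_zero.2 (by positivity)
  set f : l2 V := evec u₁ - evec u₂ with hf
  have hfv (v : V) : f v = (if v = u₁ then 1 else 0) - if v = u₂ then 1 else 0 := by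
    rw [← evec_apply, ← evec_apply]
    rfl
  have hf0 : f ≠ 0 := by
    intro h
    have := hfv u₁
    rw [h] at this
    simp [hne] at this
  have hAf : ContinuousLinearMap.adjoint A f = 0 := by
    ext v
    rw [hA.adjoint_apply]
    have hiff : u₁ ∈ T.chiFin hT v ↔ u₂ ∈ T.chiFin hT v := by
      rw [mem_chiFin] at h₁ h₂ ⊢
      rw [mem_chiFin]
      exact ⟨fun h => T.uniq_parent h h₁ ▸ h₂, fun h => T.uniq_parent h h₂ ▸ h₁⟩
    simp only [hfv, Finset.sum_sub_distrib, Finset.sum_ite_eq', hiff, sub_self, mul_zero]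
    rfl
  have hAA : ContinuousLinearMap.adjoint A (A f) = t • f := by
    ext v
    rw [hA.adjoint_apply_apply_dualWt hL (by exact_mod_cast (by omega : 1 ≤ q)), lp.coeFn_smul,
      Pi.smul_apply, smul_eq_mul]
    by_cases hv : v = u₁ ∨ v = u₂
    · have : T.depth v = k := by
        rcases hv with rfl | rfl
        · exact T.depth_of_edge ((mem_chiFin hT).1 h₁)
        · exact T.depth_of_edge ((mem_chiFin hT).1 h₂)
      rw [this]
    · push Not at hv
      rw [hfv, if_neg hv.1, if_neg hv.2, sub_self, mul_zero, mul_zero]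
  refine ⟨A f, 1 - q * t, ?_, ?_, ?_, ?_⟩
  · have hreal : (1 : ℝ) - q * (((k : ℝ) + 1) / ((k : ℝ) + q)) ≠ 0 := by
      have hq1 : (2 : ℝ) ≤ q := by exact_mod_cast hq
      have hk1 : (1 : ℝ) ≤ k := by exact_mod_cast (by omega : 1 ≤ k)
      have : (1 : ℝ) - q * (((k : ℝ) + 1) / ((k : ℝ) + q)) = k * (1 - q) / (k + q) := by
        field_simp
        ring
      rw [this]
      refine div_ne_zero (mul_ne_zero (by positivity) (by linarith)) hkq.ne'
    rw [ht]
    exact_mod_cast Complex.ofReal_ne_zero.2 hreal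
  · rw [heredDefect_iterate_apply_of_adjoint_sq_eq_zero (by rw [hAA, map_smul, hAf, smul_zero]),
      hAA, map_smul, smul_smul, sub_smul, one_smul]
  · rw [hAA]
    exact smul_ne_zero ht0 hf0
  · rw [hAA, map_smul, hAf, smul_zero]

theorem card_le_one_of_intertwine (hL : T.Leafless) (hq : 2 ≤ q)
    (hA : T.IsTreeShift hT (T.dualWt hT q) A) {N : ℕ}
    (hN : ∀ v : V, 2 ≤ (T.chiFin hT v).card → T.depth v ≤ N) {a β : ℂ} (ha : a ≠ 0)
    (hu : IsUnit (1 - (starRingEnd ℂ a) • A)) (hβ : ‖β‖ = 1) (U : l2 V ≃ₗᵢ[ℂ] l2 V)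
    (hU : ∀ f, U (A f) = mobius a β A (U f)) (p : V) : (T.chiFin hT p).card ≤ 1 := by
  by_contra! hp
  obtain ⟨z, δ, hδ, hDz, hz1, hz2⟩ := exists_defect_eigenvector hL hq hA hp
  set W : l2 V →L[ℂ] l2 V := (U.toContinuousLinearEquiv : l2 V →L[ℂ] l2 V) with hW
  have hWapp (f : l2 V) : W f = U f := rfl
  have hWW : star W * W = 1 := by
    rw [ContinuousLinearMap.star_eq_adjoint]
    exact (ContinuousLinearMap.norm_map_iff_adjoint_comp_self W).1 fun f => U.norm_map f
  have hWW' : W * star W = 1 := by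
    ext1 f
    obtain ⟨g, rfl⟩ := U.surjective f
    have := congrArg W (DFunLike.congr_fun hWW g)
    exact this
  have hint : W * A = mobius a β A * W := ContinuousLinearMap.ext hU
  set c := 1 - (starRingEnd ℂ a) • A with hc
  set r := Ring.inverse c with hr
  have hcr : c * r = 1 := Ring.mul_inverse_cancel _ hu
  set b := (starRingEnd ℂ) a with hb
  have hb0 : b ≠ 0 := by simpa [hb] using ha
  have hinv (k : ℕ) : c ^ k * r ^ k = 1 := by
    have : Commute c r := by
      rw [Commute, SemiconjBy, hcr, hr, Ring.inverse_mul_cancel _ hu]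
    rw [← this.mul_pow, hcr, one_pow]
  set X := (heredDefect A)^[q] (1 : l2 V →L[ℂ] l2 V) with hX
  have hdef : δ • (c ^ q) (W z) = (1 - a * b) ^ q • X (star (r ^ q) (W z)) := by
    have e1 : c ^ q * (W * X) = (1 - a * b) ^ q • (X * star (r ^ q) * W) := by
      rw [mul_iterate_heredDefect_of_intertwine hint hWW hWW', iterate_heredDefect_mobius hu hβ,
        smul_mul_assoc, mul_smul_comm]
      congr 1
      simp only [← mul_assoc]
      rw [hinv, one_mul]
    have e2 := DFunLike.congr_fun e1 z
    have e3 : (c ^ q * (W * X)) z = (c ^ q) (W (X z)) := rfl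
    rw [e3, hDz, map_smul, map_smul] at e2
    exact e2
  have hstar : W * star A = star (mobius a β A) * W := by
    have : star A * star W = star W * star (mobius a β A) := by
      rw [← star_mul, ← star_mul, hint]
    calc W * star A = W * (star A * star W) * W := by rw [mul_assoc, mul_assoc, hWW, mul_one]
      _ = (W * star W) * star (mobius a β A) * W := by rw [this]; simp only [mul_assoc]
      _ = _ := by rw [hWW', one_mul]
  have hcm : star c * (W * star A) = (star β) • ((star A - b • 1) * W) := by
    rw [hstar, ← mul_assoc, ← star_mul, mobius_mul_one_sub hu, star_smul, star_sub, star_smul,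
      star_one, smul_mul_assoc]
    rfl
  have hcm_app (f : l2 V) : star c (W (ContinuousLinearMap.adjoint A f)) =
      star β • (ContinuousLinearMap.adjoint A (W f) - b • W f) := DFunLike.congr_fun hcm f
  have hβ0 : star β ≠ 0 := by
    intro h
    rw [star_eq_zero] at h
    simp [h] at hβ
  have hcs : IsUnit (star c) := hu.star
  have hcs0 {f : l2 V} (h : star c f = 0) : f = 0 := by
    have := DFunLike.congr_fun (Ring.inverse_mul_cancel _ hcs) f
    have e : (Ring.inverse (star c) * star c) f = Ring.inverse (star c) (star c f) := rfl
    rw [e, h, map_zero] at this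
    exact this.symm
  have hccomm : star c * (star A - b • 1) = (star A - b • 1) * star c := by
    have : star c = 1 - a • star A := by
      rw [hc, star_sub, star_smul, star_one, hb]
      simp
    rw [this]
    simp only [sub_mul, mul_sub, one_mul, mul_one, smul_mul_assoc, mul_smul_comm, smul_sub]
    rw [smul_comm b a]
    abel
  have hzero : ContinuousLinearMap.adjoint A (W z) - b • W z = 0 := by
    refine adjoint_eq_smul_of_sq hL (by omega) hA hN hb0 (g := W z)
      (f := (δ⁻¹ * (1 - a * b) ^ q) • star (r ^ q) (W z)) ?_ ?_
    · rw [map_smul, mul_smul, ← hX, ← hdef, smul_smul, inv_mul_cancel₀ hδ, one_smul]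
    · have e1 := hcm_app (ContinuousLinearMap.adjoint A z)
      rw [hz2, map_zero, map_zero] at e1
      have e2 := (smul_eq_zero.1 e1.symm).resolve_left hβ0
      set y := W (ContinuousLinearMap.adjoint A z) with hy
      have e3 : (star A - b • 1) (star c y) = 0 := by
        have := DFunLike.congr_fun hccomm y
        have e4 : (star c * (star A - b • 1)) y =
          star c (ContinuousLinearMap.adjoint A y - b • y) := rfl
        rw [e4, e2, map_zero] at this
        exact this.symm
      rw [hcm_app, map_smul] at e3
      have e5 := (smul_eq_zero.1 e3).resolve_left hβ0
      exact sub_eq_zero.1 e5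
  have hlast := hcm_app z
  rw [hzero, smul_zero] at hlast
  have := hcs0 hlast
  rw [hWapp, LinearIsometryEquiv.map_eq_zero_iff] at this
  exact hz1 this

end DualShift

end DirTree

theorem star_mobius {A : Type*} [Ring A] [Algebra ℂ A] [StarRing A] [StarModule ℂ A] {a β : ℂ}
    {x : A} (hu : IsUnit (1 - (starRingEnd ℂ a) • x)) :
    star (mobius a β x) = mobius ((starRingEnd ℂ) a) ((starRingEnd ℂ) β) (star x) := by
  rw [mobius_eq_inverse_mul hu, mobius]
  simp [← Ring.inverse_star]

/-- `A` acts on `ℓ²(V)` as the unilateral weighted shift with weights `w` along the enumeration `v`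
of `V`. -/
structure IsPathShift {V : Type} (v : ℕ ≃ V) (w : ℕ → ℝ) (A : l2 V →L[ℂ] l2 V) : Prop where
  apply_zero : ∀ f : l2 V, (A f) (v 0) = 0
  apply_succ : ∀ (f : l2 V) (j : ℕ), (A f) (v (j + 1)) = w j * f (v j)
  adjoint_apply : ∀ (f : l2 V) (j : ℕ), (ContinuousLinearMap.adjoint A f) (v j) =
    w j * f (v (j + 1))

namespace IsPathShift

variable {V : Type} {v : ℕ ≃ V} {w : ℕ → ℝ} {A : l2 V →L[ℂ] l2 V} {a β : ℂ} {q : ℕ}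

theorem ext_path {f g : l2 V} (v : ℕ ≃ V) (h : ∀ j, f (v j) = g (v j)) : f = g := by
  refine lp.ext (funext fun x => ?_)
  obtain ⟨j, rfl⟩ := v.surjective x
  exact h j

theorem adjoint_mobius_mobius_apply (hA : IsPathShift v w A) (hq : 2 ≤ q)
    (hw : ∀ j : ℕ, (w j : ℂ) ^ 2 = ((j : ℂ) + 1) / ((j : ℂ) + q))
    (hu : IsUnit (1 - (starRingEnd ℂ a) • A)) (hβ : ‖β‖ = 1) {n : ℕ} {y : l2 V}
    (hy : mobius a β A (star (mobius a β A) y) = ((n : ℂ) / (n + q - 1)) • y) :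
    star (mobius a β A) (mobius a β A y) = (((n : ℂ) + 1) / (n + q)) • y := by
  have hnq (j : ℕ) : (j : ℂ) + q ≠ 0 := by
    have : ((j + q : ℕ) : ℂ) ≠ 0 := Nat.cast_ne_zero.2 (by omega)
    exact_mod_cast this
  have hnq' (j : ℕ) : (j : ℂ) + q - 1 ≠ 0 := by
    obtain ⟨p, rfl⟩ : ∃ p, q = p + 1 := ⟨q - 1, by omega⟩
    have : ((j + p : ℕ) : ℂ) ≠ 0 := Nat.cast_ne_zero.2 (by omega)
    push_cast at this ⊢
    rwa [← add_assoc, add_sub_cancel_right]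
  have hq1 : (q : ℂ) - 1 ≠ 0 := by simpa using hnq' 0
  have hw' (j : ℕ) : (w j : ℂ) * w j * (j + q) = j + 1 := by
    rw [← sq, hw, div_mul_cancel₀ _ (hnq j)]
  have hu' : IsUnit (1 - (starRingEnd ℂ ((starRingEnd ℂ) a)) • star A) := by
    simpa using hu.star
  have d1 := heredDefect_mobius hu hβ 1
  have d2 := heredDefect_mobius (β := (starRingEnd ℂ) β) hu' (by simpa using hβ) 1
  rw [← star_mobius hu] at d2
  set φ := mobius a β A
  set c := 1 - (starRingEnd ℂ a) • A with hc
  have hc' : 1 - (starRingEnd ℂ ((starRingEnd ℂ) a)) • star A = star c := by simp [hc]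
  rw [hc', Ring.inverse_star, star_star] at d2
  set r := Ring.inverse c
  set κ : ℂ := 1 - a * (starRingEnd ℂ) a with hκ
  have hrc (f : l2 V) : r (c f) = f := by
    rw [← mul_apply_eq_comp, Ring.inverse_mul_cancel _ hu, one_apply_eq_self]
  have hcr (f : l2 V) : c (r f) = f := by
    rw [← mul_apply_eq_comp, Ring.mul_inverse_cancel _ hu, one_apply_eq_self]
  have hcs (f : l2 V) : star c (star r f) = f := by
    rw [← mul_apply_eq_comp, ← star_mul, Ring.inverse_mul_cancel _ hu, star_one, one_apply_eq_self]
  have hsc (f : l2 V) : star r (star c f) = f := by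
    rw [← mul_apply_eq_comp, ← star_mul, Ring.mul_inverse_cancel _ hu, star_one, one_apply_eq_self]
  have d1' (f : l2 V) : f - φ (star φ f) = κ • r (star r f - A (star A (star r f))) := by
    have := congrArg (fun B : l2 V →L[ℂ] l2 V => B f) d1
    simpa [heredDefect, mul_apply_eq_comp] using this
  have d2' (f : l2 V) : f - star φ (φ f) = κ • star r (r f - star A (A (r f))) := by
    have := congrArg (fun B : l2 V →L[ℂ] l2 V => B f) d2
    simpa [heredDefect, mul_apply_eq_comp, mul_comm] using this
  have hκ1 : κ + a * (starRingEnd ℂ) a = 1 := by rw [hκ]; ring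
  have hcoord0 (f : l2 V) : (c f) (v 0) = f (v 0) := by
    have : (c f) (v 0) = f (v 0) - (starRingEnd ℂ) a * (A f) (v 0) := rfl
    rw [this, hA.apply_zero, mul_zero, sub_zero]
  have hcoord (f : l2 V) (j : ℕ) :
      (c f) (v (j + 1)) = f (v (j + 1)) - (starRingEnd ℂ) a * (w j * f (v j)) := by
    rw [← hA.apply_succ]
    rfl
  have hscoord (f : l2 V) (j : ℕ) :
      (star c f) (v j) = f (v j) - a * (w j * f (v (j + 1))) := by
    rw [← hA.adjoint_apply, ← hc', Complex.conj_conj]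
    rfl
  set u := star r y with hu_def
  set p := r y with hp_def
  have hu1 (j : ℕ) : κ * (n + q - 1) * u (v j) = (j + q - 1) * (c y) (v j) := by
    have e1 : κ • (u - A (star A u)) = (((q : ℂ) - 1) / (n + q - 1)) • c y := by
      have e2 := d1' y
      rw [hy] at e2
      have e3 := congrArg c e2
      rw [map_smul, hcr] at e3
      rw [← e3, map_sub, map_smul]
      nth_rewrite 1 [← one_smul ℂ (c y)]
      rw [← sub_smul]
      congr 1
      field_simp [hnq' n]
      ring
    have e4 : κ * (u (v j) - (A (star A u)) (v j)) =
        (((q : ℂ) - 1) / (n + q - 1)) * (c y) (v j) := congrArg (fun f : l2 V => f (v j)) e1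
    have e5 : (A (star A u)) (v j) * (j + q - 1) = j * u (v j) := by
      cases j with
      | zero => rw [hA.apply_zero]; simp
      | succ j =>
        have : (star A u) (v j) = w j * u (v (j + 1)) := hA.adjoint_apply u j
        rw [hA.apply_succ, this]
        push_cast
        linear_combination u (v (j + 1)) * hw' j
    have hne := hnq' n
    rw [div_mul_eq_mul_div, eq_div_iff hne] at e4
    refine mul_left_cancel₀ hq1 ?_
    linear_combination (j + q - 1 : ℂ) * e4 + κ * (n + q - 1 : ℂ) * e5
  have hy1 (j : ℕ) : κ * (n + q - 1) * y (v j) =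
      (j + q - 1) * (c y) (v j) - a * w j * ((j + q) * (c y) (v (j + 1))) := by
    have e1 : y (v j) = u (v j) - a * (w j * u (v (j + 1))) := by
      rw [← hscoord, hcs]
    have e2 := hu1 (j + 1)
    push_cast at e2
    rw [e1]
    linear_combination hu1 j - a * w j * e2
  have hp0 : p (v 0) = y (v 0) := by rw [← hcoord0, hcr]
  have hp (j : ℕ) : p (v (j + 1)) = y (v (j + 1)) + (starRingEnd ℂ) a * (w j * p (v j)) := by
    have := hcoord p j
    rw [hcr] at this
    rw [this]
    ring
  have hpm (j : ℕ) : κ * (n + q) * p (v j) = (j + q) * (star c y) (v j) := by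
    induction j with
    | zero =>
      have e1 := hy1 0
      have e2 := hw' 0
      rw [hcoord, hcoord0] at e1
      rw [hp0, hscoord]
      push_cast at e1 e2 ⊢
      linear_combination e1 + (a * (starRingEnd ℂ) a * y (v 0)) * e2 + y (v 0) * hκ1
    | succ j ih =>
      have e1 := hy1 (j + 1)
      have e2 := hw' (j + 1)
      have e3 := hw' j
      rw [hcoord, hcoord] at e1
      rw [hscoord] at ih ⊢
      rw [hp]
      push_cast at e1 e2 ⊢
      linear_combination e1 + (starRingEnd ℂ) a * w j * ih +
        (a * (starRingEnd ℂ) a * y (v (j + 1))) * (e2 - e3) + y (v (j + 1)) * hκ1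
  have hfin : κ • (p - star A (A p)) = (((q : ℂ) - 1) / (n + q)) • star c y := by
    refine ext_path v fun j => ?_
    have e1 : (star A (A p)) (v j) * (j + q) = (j + 1) * p (v j) := by
      have : (star A (A p)) (v j) = w j * (A p) (v (j + 1)) := hA.adjoint_apply _ j
      rw [this, hA.apply_succ]
      linear_combination p (v j) * hw' j
    change κ * (p (v j) - (star A (A p)) (v j)) = (((q : ℂ) - 1) / (n + q)) * (star c y) (v j)
    rw [div_mul_eq_mul_div, eq_div_iff (hnq n)]
    refine mul_left_cancel₀ (hnq j) ?_
    linear_combination ((q : ℂ) - 1) * hpm j - κ * (n + q) * e1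
  have e := d2' y
  rw [← map_smul, hfin, map_smul, hsc] at e
  rw [← sub_eq_zero]
  have : star φ (φ y) - (((n : ℂ) + 1) / (n + q)) • y =
      ((((q : ℂ) - 1) / (n + q)) • y - (y - star φ (φ y))) +
        (1 - ((q : ℂ) - 1) / (n + q) - ((n : ℂ) + 1) / (n + q)) • y := by module
  rw [this, e, sub_self, zero_add]
  have h0 : (1 - ((q : ℂ) - 1) / (n + q) - ((n : ℂ) + 1) / (n + q)) = 0 := by
    field_simp [hnq n]
    ring
  rw [h0, zero_smul]

end IsPathShift

theorem exists_orthonormal_weighted_shift {H : Type*} [NormedAddCommGroup H]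
    [InnerProductSpace ℂ H] [CompleteSpace H] {φ : H →L[ℂ] H} {w : ℕ → ℝ} {s : ℕ → ℂ} {f : H}
    (hw : ∀ n, 0 < w n) (hs0 : s 0 = 0) (hs : ∀ n, s (n + 1) = (w n : ℂ) ^ 2)
    (hstep : ∀ n y, φ (star φ y) = s n • y → star φ (φ y) = s (n + 1) • y)
    (hf : ‖f‖ = 1) (hf0 : star φ f = 0) :
    ∃ ψ : ℕ → H, Orthonormal ℂ ψ ∧ star φ (ψ 0) = 0 ∧
      (∀ n, star φ (ψ (n + 1)) = (w n : ℂ) • ψ n) ∧ ∀ n, φ (ψ n) = (w n : ℂ) • ψ (n + 1) := by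
  have hw0 (n : ℕ) : (w n : ℂ) ≠ 0 := Complex.ofReal_ne_zero.2 (hw n).ne'
  let ψ : ℕ → H := fun n => Nat.rec f (fun n x => (w n : ℂ)⁻¹ • φ x) n
  have h0 : star φ (ψ 0) = 0 := hf0
  have hφ (n : ℕ) : φ (ψ n) = (w n : ℂ) • ψ (n + 1) := (smul_inv_smul₀ (hw0 n) _).symm
  have hmain (n : ℕ) : star φ (φ (ψ n)) = (w n : ℂ) ^ 2 • ψ n := by
    induction n with
    | zero => rw [← hs]; exact hstep 0 _ (by rw [h0, map_zero, hs0, zero_smul])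
    | succ n ih =>
      rw [← hs]
      refine hstep _ _ ?_
      have e : ψ (n + 1) = (w n : ℂ)⁻¹ • φ (ψ n) := rfl
      rw [e, map_smul, ih, map_smul, map_smul, hs, smul_comm]
  have hadj (n : ℕ) : star φ (ψ (n + 1)) = (w n : ℂ) • ψ n := by
    have e : ψ (n + 1) = (w n : ℂ)⁻¹ • φ (ψ n) := rfl
    rw [e, map_smul, hmain, smul_smul, sq, inv_mul_cancel_left₀ (hw0 n)]
  have hin (x y : H) : ⟪x, φ y⟫_ℂ = ⟪star φ x, y⟫_ℂ := (adjoint_inner_left φ y x).symm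
  have hzero (n : ℕ) : ⟪ψ 0, ψ (n + 1)⟫_ℂ = 0 := by
    have e : ψ (n + 1) = (w n : ℂ)⁻¹ • φ (ψ n) := rfl
    rw [e, inner_smul_right, hin, h0, inner_zero_left, mul_zero]
  refine ⟨ψ, orthonormal_iff_ite.2 fun i => ?_, h0, hadj, hφ⟩
  induction i with
  | zero =>
    intro j
    cases j with
    | zero =>
      have : ⟪f, f⟫_ℂ = 1 := by rw [inner_self_eq_norm_sq_to_K, hf]; simp
      rw [if_pos rfl]
      exact this
    | succ j => rw [hzero]; simp
  | succ i ih =>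
    intro j
    cases j with
    | zero => rw [← inner_conj_symm, hzero]; simp
    | succ j =>
      have e : ψ (j + 1) = (w j : ℂ)⁻¹ • φ (ψ j) := rfl
      rw [e, inner_smul_right, hin, hadj, inner_smul_left, ih]
      by_cases hij : i = j
      · subst hij
        simp [hw0 i]
      · simp [hij]

namespace IsPathShift

variable {V : Type} {v : ℕ ≃ V} {w : ℕ → ℝ} {A : l2 V →L[ℂ] l2 V} {a β : ℂ} {q : ℕ}

theorem apply_evec (hA : IsPathShift v w A) (j : ℕ) :
    A (evec (v j)) = (w j : ℂ) • evec (v (j + 1)) := by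
  classical
  refine ext_path v fun i => ?_
  change _ = (w j : ℂ) * (evec (v (j + 1)) : l2 V) (v i)
  cases i with
  | zero => rw [hA.apply_zero, evec_apply]; simp
  | succ i =>
    rw [hA.apply_succ, evec_apply, evec_apply]
    by_cases hij : i = j
    · subst hij; simp
    · simp [hij]

theorem adjoint_apply_evec_zero (hA : IsPathShift v w A) : star A (evec (v 0)) = 0 := by
  classical
  refine ext_path v fun i => ?_
  refine (hA.adjoint_apply _ i).trans ?_
  rw [evec_apply]
  simp

/-- The unilateral weighted shift is irreducible. -/
theorem eq_zero_of_commute (hA : IsPathShift v w A) (hw : ∀ j, 0 < w j) {P : l2 V →L[ℂ] l2 V}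
    (hP : IsSelfAdjoint P) (hPA : Commute P A) {f : l2 V} (hf : f ≠ 0) (hPf : P f = 0) :
    P = 0 := by
  classical
  have hw0 (n : ℕ) : (w n : ℂ) ≠ 0 := Complex.ofReal_ne_zero.2 (hw n).ne'
  have hPA' : Commute P (star A) := by simpa [hP.star_eq] using hPA.star_star
  have happ (g : l2 V) : P (A g) = A (P g) := congrArg (fun B : l2 V →L[ℂ] l2 V => B g) hPA.eq
  have happ' (g : l2 V) : P (star A g) = star A (P g) :=
    congrArg (fun B : l2 V →L[ℂ] l2 V => B g) hPA'.eq
  set t : ℂ := (P (evec (v 0))) (v 0) with ht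
  have hP0 : P (evec (v 0)) = t • evec (v 0) := by
    refine ext_path v fun i => ?_
    change _ = t * (evec (v 0) : l2 V) (v i)
    cases i with
    | zero => simp [evec_apply, ht]
    | succ i =>
      have e := happ' (evec (v 0))
      rw [hA.adjoint_apply_evec_zero, map_zero] at e
      have e1 := hA.adjoint_apply (P (evec (v 0))) i
      have e2 : (ContinuousLinearMap.adjoint A (P (evec (v 0)))) (v i) = 0 :=
        (congrArg (fun g : l2 V => g (v i)) e).symm
      rw [e2] at e1
      rw [(mul_eq_zero.1 e1.symm).resolve_left (hw0 i), evec_apply]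
      simp
  have hPe (j : ℕ) : P (evec (v j)) = t • evec (v j) := by
    induction j with
    | zero => exact hP0
    | succ j ih =>
      have e := happ (evec (v j))
      rw [ih, map_smul, hA.apply_evec, map_smul, smul_comm] at e
      exact smul_right_injective _ (hw0 j) e
  have hPg (g : l2 V) (j : ℕ) : (P g) (v j) = (starRingEnd ℂ) t * g (v j) := by
    rw [← inner_evec_left, ← inner_evec_left, ← inner_smul_left, ← hPe,
      ← ContinuousLinearMap.adjoint_inner_left, ← star_eq_adjoint, hP.star_eq]
  have ht0 : (starRingEnd ℂ) t = 0 := by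
    by_contra hne
    refine hf (ext_path v fun j => ?_)
    have := hPg f j
    rw [hPf] at this
    exact (mul_eq_zero.1 this.symm).resolve_left hne
  ext1 g
  refine ext_path v fun j => ?_
  rw [hPg, ht0, zero_mul]
  rfl

theorem exists_adjoint_eigenvector (hA : IsPathShift v w A) (hw0 : ∀ j, 0 < w j)
    (hw : ∀ j : ℕ, (w j : ℂ) ^ 2 = ((j : ℂ) + 1) / ((j : ℂ) + q)) {b : ℂ} (hb : ‖b‖ < 1) :
    ∃ k : l2 V, ‖k‖ = 1 ∧ star A k = b • k := by
  have hwne (n : ℕ) : (w n : ℂ) ≠ 0 := Complex.ofReal_ne_zero.2 (hw0 n).ne'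
  set g : ℕ → ℂ := fun j => ∏ i ∈ Finset.range j, b / w i with hg
  have hgs (j : ℕ) : g (j + 1) = g j * (b / w j) := Finset.prod_range_succ _ _
  have hwr (j : ℕ) : w j ^ 2 = ((j : ℝ) + 1) / ((j : ℝ) + q) := by
    apply Complex.ofReal_injective
    push_cast
    exact hw j
  have hratio (j : ℕ) : ‖g (j + 1)‖ ^ 2 =
      ‖b‖ ^ 2 * (1 + ((q : ℝ) - 1) * (1 / ((j : ℝ) + 1))) * ‖g j‖ ^ 2 := by
    have e : (‖b‖ / w j) ^ 2 = ‖b‖ ^ 2 * (1 + ((q : ℝ) - 1) * (1 / ((j : ℝ) + 1))) := by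
      rw [div_pow, hwr]
      have h1 : (j : ℝ) + 1 ≠ 0 := by positivity
      field_simp
      ring
    rw [hgs, norm_mul, norm_div, Complex.norm_real, Real.norm_of_nonneg (hw0 j).le, mul_pow, e,
      mul_comm]
  have hb2 : ‖b‖ ^ 2 < 1 := by nlinarith [norm_nonneg b]
  obtain ⟨ρ, hρ1, hρ2⟩ := exists_between hb2
  have hlim : Filter.Tendsto (fun j : ℕ => ‖b‖ ^ 2 * (1 + ((q : ℝ) - 1) * (1 / ((j : ℝ) + 1))))
      Filter.atTop (nhds (‖b‖ ^ 2)) := by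
    have := ((tendsto_one_div_add_atTop_nhds_zero_nat (𝕜 := ℝ)).const_mul
      ((q : ℝ) - 1)).const_add 1 |>.const_mul (‖b‖ ^ 2)
    simpa using this
  have hsum : Summable fun j => ‖g j‖ ^ 2 := by
    refine summable_of_ratio_norm_eventually_le hρ2 ?_
    filter_upwards [hlim.eventually_le_const hρ1] with j hj
    rw [Real.norm_of_nonneg (by positivity), Real.norm_of_nonneg (by positivity), hratio]
    gcongr
  have hmem : Memℓp (fun x : V => g (v.symm x)) 2 := by
    refine memℓp_gen ?_
    have := (v.symm.summable_iff (f := fun j => ‖g j‖ ^ 2)).2 hsum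
    simpa [Function.comp_def] using this
  set k : l2 V := ⟨fun x => g (v.symm x), hmem⟩
  have hkv (j : ℕ) : k (v j) = g j := congrArg g (v.symm_apply_apply j)
  have hk0 : k ≠ 0 := by
    intro h
    have := hkv 0
    rw [h] at this
    simp [hg] at this
  have hAk : star A k = b • k := by
    refine ext_path v fun j => (hA.adjoint_apply k j).trans ?_
    change _ = b * k (v j)
    rw [hkv, hkv, hgs]
    field_simp [hwne j]
  refine ⟨(‖k‖⁻¹ : ℂ) • k, ?_, ?_⟩
  · exact norm_smul_inv_norm hk0
  · rw [map_smul, hAk, smul_comm]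

/-- An operator that commutes with a Möbius image of `x` commutes with `x`. -/
theorem _root_.Commute.of_mobius {R : Type*} [Ring R] [Algebra ℂ R] {x P : R}
    (hu : IsUnit (1 - (starRingEnd ℂ a) • x)) (ha : ‖a‖ < 1) (hβ : ‖β‖ = 1)
    (h : Commute P (mobius a β x)) : Commute P x := by
  have hβ0 : β ≠ 0 := norm_ne_zero_iff.1 (by rw [hβ]; exact one_ne_zero)
  have hκ : (1 - a * (starRingEnd ℂ) a) ≠ 0 := by
    rw [Complex.mul_conj, Complex.normSq_eq_norm_sq]
    have : ‖a‖ ^ 2 < 1 := by nlinarith [norm_nonneg a]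
    intro e
    have e' : ((1 - ‖a‖ ^ 2 : ℝ) : ℂ) = 0 := by exact_mod_cast e
    rw [Complex.ofReal_eq_zero] at e'
    linarith
  have hm := mobius_mul_one_sub (β := β) hu
  set φ := mobius a β x
  set c := 1 - (starRingEnd ℂ a) • x with hc
  have hd : (β • 1 + (starRingEnd ℂ) a • φ) * c = (β * (1 - a * (starRingEnd ℂ) a)) • 1 := by
    rw [add_mul, smul_mul_assoc, smul_mul_assoc, hm, hc]
    simp only [one_mul, smul_sub, smul_smul, mul_sub, sub_smul, mul_one]
    rw [mul_comm ((starRingEnd ℂ) a) β, mul_left_comm ((starRingEnd ℂ) a) β a,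
      mul_comm ((starRingEnd ℂ) a) a]
    abel
  have hr : Ring.inverse c = (β * (1 - a * (starRingEnd ℂ) a))⁻¹ •
      (β • 1 + (starRingEnd ℂ) a • φ) := by
    have hd' : ((β * (1 - a * (starRingEnd ℂ) a))⁻¹ • (β • 1 + (starRingEnd ℂ) a • φ)) * c = 1 := by
      rw [smul_mul_assoc, hd, inv_smul_smul₀ (mul_ne_zero hβ0 hκ)]
    calc Ring.inverse c = _ * c * Ring.inverse c := by rw [hd', one_mul]
      _ = _ := by rw [mul_assoc, Ring.mul_inverse_cancel _ hu, mul_one]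
  have hPr : Commute P (Ring.inverse c) := by
    rw [hr]
    exact (((Commute.one_right P).smul_right β).add_right (h.smul_right _)).smul_right _
  have hPc : Commute P c := by
    calc P * c = c * (Ring.inverse c * P) * c := by rw [Ring.mul_inverse_cancel_left _ _ hu]
      _ = c * P := by
        rw [← hPr.eq, mul_assoc, mul_assoc, Ring.inverse_mul_cancel _ hu, mul_one]
  have hx : x = β⁻¹ • (φ * c) + a • 1 := by
    rw [hm, inv_smul_smul₀ hβ0, sub_add_cancel]
  rw [hx]
  exact ((h.mul_right hPc).smul_right _).add_right ((Commute.one_right P).smul_right a)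

/-- A unilateral weighted shift with weights `√((j+1)/(j+q))` is homogeneous. -/
theorem exists_intertwine (hA : IsPathShift v w A) (hw0 : ∀ j, 0 < w j) (hq : 2 ≤ q)
    (hw : ∀ j : ℕ, (w j : ℂ) ^ 2 = ((j : ℂ) + 1) / ((j : ℂ) + q))
    (hu : IsUnit (1 - (starRingEnd ℂ a) • A)) (ha : ‖a‖ < 1) (hβ : ‖β‖ = 1) :
    ∃ U : l2 V ≃ₗᵢ[ℂ] l2 V, ∀ f, U (A f) = mobius a β A (U f) := by
  obtain ⟨k, hk, hAk⟩ := hA.exists_adjoint_eigenvector hw0 hw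
    (b := (starRingEnd ℂ) a) (by simpa using ha)
  have hk0 : star (mobius a β A) k = 0 := by
    rw [mobius, star_smul, star_mul, star_sub, star_smul, star_one]
    change star β • star (Ring.inverse (1 - (starRingEnd ℂ) a • A))
      (star A k - (starRingEnd ℂ) a • k) = 0
    rw [hAk, sub_self, map_zero, smul_zero]
  obtain ⟨ψ, hψ, hψ0, hψs, hψφ⟩ := exists_orthonormal_weighted_shift (φ := mobius a β A) (w := w)
    (s := fun n => (n : ℂ) / (n + q - 1)) hw0 (by simp)
    (fun n => by rw [hw]; push_cast; ring)
    (fun n y h => by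
      rw [hA.adjoint_mobius_mobius_apply hq hw hu hβ h]
      push_cast
      congr 2
      ring) hk hk0
  set φ := mobius a β A with hφ
  set M := Submodule.span ℂ (Set.range ψ)
  have hM1 : M ∈ Module.End.invtSubmodule (φ : l2 V →ₗ[ℂ] l2 V) := by
    rw [Module.End.mem_invtSubmodule]
    refine Submodule.span_le.2 ?_
    rintro _ ⟨n, rfl⟩
    change φ (ψ n) ∈ M
    rw [hψφ]
    exact M.smul_mem _ (Submodule.subset_span ⟨_, rfl⟩)
  have hM2 : M ∈ Module.End.invtSubmodule (ContinuousLinearMap.adjoint φ : l2 V →ₗ[ℂ] l2 V) := by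
    rw [Module.End.mem_invtSubmodule]
    refine Submodule.span_le.2 ?_
    rintro _ ⟨n, rfl⟩
    change star φ (ψ n) ∈ M
    cases n with
    | zero => rw [hψ0]; exact M.zero_mem
    | succ n => rw [hψs]; exact M.smul_mem _ (Submodule.subset_span ⟨_, rfl⟩)
  have hP := isStarProjection_starProjection (U := Mᗮ)
  have hK1 : Mᗮ ∈ Module.End.invtSubmodule (φ : l2 V →ₗ[ℂ] l2 V) :=
    ContinuousLinearMap.orthogonal_mem_invtSubmodule hM2
  have hK2 : Mᗮ ∈ Module.End.invtSubmodule (ContinuousLinearMap.adjoint φ : l2 V →ₗ[ℂ] l2 V) :=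
    ContinuousLinearMap.orthogonal_mem_invtSubmodule (by rwa [ContinuousLinearMap.adjoint_adjoint])
  have hPφ : Commute Mᗮ.starProjection φ := by
    rw [ContinuousLinearMap.IsIdempotentElem.commute_iff hP.isIdempotentElem,
      Submodule.range_starProjection, Submodule.ker_starProjection]
    exact ⟨hK1, ContinuousLinearMap.orthogonal_mem_invtSubmodule hK2⟩
  have hψM : ψ 0 ∈ M := Submodule.subset_span ⟨0, rfl⟩
  have hP0 : Mᗮ.starProjection = 0 :=
    hA.eq_zero_of_commute hw0 hP.isSelfAdjoint (Commute.of_mobius hu ha hβ hPφ)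
      (hψ.ne_zero 0) (by
        rw [Submodule.starProjection_apply_eq_zero_iff]
        exact Submodule.le_orthogonal_orthogonal M hψM)
  have hbot : Mᗮ = ⊥ := by
    rw [← Submodule.range_starProjection Mᗮ, hP0]
    simp
  have hrange : Set.range (ψ ∘ v.symm) = Set.range ψ := v.symm.surjective.range_comp ψ
  let b : HilbertBasis V ℂ (l2 V) := HilbertBasis.mkOfOrthogonalEqBot
    (hψ.comp _ v.symm.injective) (by rw [hrange]; exact hbot)
  have hb (g : l2 V) (j : ℕ) : (b.repr g) (v j) = ⟪ψ j, g⟫_ℂ := by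
    rw [HilbertBasis.repr_apply_apply]
    simp [b]
  have key (g : l2 V) : b.repr (φ g) = A (b.repr g) := by
    refine ext_path v fun j => ?_
    rw [hb, ← ContinuousLinearMap.adjoint_inner_left, ← star_eq_adjoint]
    cases j with
    | zero => rw [hψ0, inner_zero_left, hA.apply_zero]
    | succ j => rw [hψs, inner_smul_left, hA.apply_succ, hb, Complex.conj_ofReal]
  refine ⟨b.repr.symm, fun f => ?_⟩
  rw [LinearIsometryEquiv.symm_apply_eq, key, LinearIsometryEquiv.apply_symm_apply]

end IsPathShift

namespace DirTree

variable {V : Type} {T : DirTree V}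

theorem exists_equiv_nat (hL : T.Leafless) (hT : T.LocFin)
    (hc : ∀ v : V, (T.chiFin hT v).card ≤ 1) :
    ∃ v : ℕ ≃ V, v 0 = T.root ∧ (∀ j, T.depth (v j) = j) ∧ ∀ j, T.edge (v j) (v (j + 1)) := by
  choose s hs using hL
  let p : ℕ → V := fun n => Nat.rec T.root (fun _ x => s x) n
  have hp (j : ℕ) : T.edge (p j) (p (j + 1)) := hs (p j)
  have hd (j : ℕ) : T.depth (p j) = j := by
    induction j with
    | zero => exact T.depth_root
    | succ j ih => rw [T.depth_of_edge (hp j), ih]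
  have hsurj (n : ℕ) : ∀ u : V, T.depth u = n → p n = u := by
    induction n with
    | zero => exact fun u hu => (T.eq_root_of_depth_eq_zero hu).symm
    | succ n ih =>
      intro u hu
      obtain ⟨x, hx⟩ := T.exists_edge_of_depth_pos (by omega : 0 < T.depth u)
      have hxn : T.depth x = n := by
        have := T.depth_of_edge hx
        omega
      obtain rfl := ih x hxn
      have h1 := T.chiFin_eq_singleton hT (hc _) hx
      have h2 := (T.mem_chiFin hT).2 (hp n)
      rw [h1, Finset.mem_singleton] at h2
      exact h2
  refine ⟨⟨p, T.depth, hd, fun u => hsurj _ u rfl⟩, rfl, hd, hp⟩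

theorem IsTreeShift.exists_isPathShift (hL : T.Leafless) {hT : T.LocFin} {q : ℕ} (hq : 1 ≤ q)
    {A : l2 V →L[ℂ] l2 V} (hA : T.IsTreeShift hT (T.dualWt hT q) A)
    (hc : ∀ v : V, (T.chiFin hT v).card ≤ 1) :
    ∃ (v : ℕ ≃ V) (w : ℕ → ℝ), IsPathShift v w A ∧ (∀ j, 0 < w j) ∧
      ∀ j : ℕ, (w j : ℂ) ^ 2 = ((j : ℂ) + 1) / ((j : ℂ) + q) := by
  obtain ⟨v, hv0, hvd, hve⟩ := exists_equiv_nat hL hT hc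
  have hq' : (1 : ℝ) ≤ q := by exact_mod_cast hq
  refine ⟨v, fun j => T.dualWt hT q (v j), ⟨fun f => ?_, fun f j => hA.apply_of_edge f (hve j),
    fun f j => hA.adjoint_apply_of_card_le_one f (hc _) (hve j)⟩, fun j => dualWt_pos hL hT hq' _,
    fun j => ?_⟩
  · rw [hv0, hA.apply_root]
  · have := dualWt_sq_of_card_le_one hL hT hq' (hc (v j))
    rw [hvd] at this
    simpa using this

end DirTree

theorem stmt_19 {V : Type} [Countable V] [Infinite V] (T : DirTree V)
    (hL : T.Leafless) (hT : T.LocFin)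
    (hb : ∃ N : ℕ, ∀ v : V, 2 ≤ (T.chiFin hT v).card → T.depth v ≤ N)
    (q : ℕ) (hq : 2 ≤ q)
    (S : l2 V →L[ℂ] l2 V) (hS : T.IsDirichletShift hT (q : ℝ) S) :
    (∀ a : ℂ, ‖a‖ < 1 → IsUnit (1 - (starRingEnd ℂ a) • cauchyDual S)) ∧
      ((∀ a β : ℂ, ‖a‖ < 1 → ‖β‖ = 1 →
          ∃ U : l2 V ≃ₗᵢ[ℂ] l2 V, ∀ f : l2 V,
            U (cauchyDual S f) =
              (β • ((cauchyDual S - a • 1) *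
                Ring.inverse (1 - (starRingEnd ℂ a) • cauchyDual S))) (U f)) ↔
        ∀ v : V, (T.chiFin hT v).card ≤ 1) := by
  have hq' : (1 : ℝ) ≤ q := by exact_mod_cast (by omega : 1 ≤ q)
  have hA := DirTree.isTreeShift_cauchyDual hL hT hq' hS
  have hu (a : ℂ) (ha : ‖a‖ < 1) : IsUnit (1 - (starRingEnd ℂ a) • cauchyDual S) := by
    refine isUnit_one_sub_of_norm_lt_one ?_
    rw [norm_smul, RCLike.norm_conj]
    calc ‖a‖ * ‖cauchyDual S‖ ≤ ‖a‖ * 1 := by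
          gcongr
          exact hA.norm_le_one_of_dualWt hL hq'
      _ < 1 := by rwa [mul_one]
  refine ⟨hu, fun h => ?_, fun hc a β ha hβ => ?_⟩
  · obtain ⟨N, hN⟩ := hb
    have ha : ‖(1 / 2 : ℂ)‖ < 1 := by norm_num
    obtain ⟨U, hU⟩ := h (1 / 2) 1 ha norm_one
    exact DirTree.card_le_one_of_intertwine hL hq hA hN (by norm_num) (hu _ ha) norm_one U hU
  · obtain ⟨v, w, hP, hw0, hw⟩ := hA.exists_isPathShift hL (by omega) hc
    exact hP.exists_intertwine hw0 hq hw (hu a ha) ha hβ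

end
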